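/- Let q ≥ 2 be an integer and set p = 2q. Then for every real polynomial μ of degree at most q, there exists a nonzero real polynomial v of degree at most p with v(0) = v(1) = 0 such that ∫₀¹ μ(x)·v(x) dx ≥ (1/√2) · ‖μ‖_{L²(0,1)} · ‖v‖_{L²(0,1)}, where ‖f‖_{L²(0,1)} = (∫₀¹ f(x)² dx)^{1/2}. -/

import Mathlib

open Polynomial in
/-- integral over the unit interval, as a linear map -/
noncomputable def II : ℝ[X] →ₗ[ℝ] ℝ where
  toFun f := ∫ x in (0:ℝ)..1, f.eval x
  map_add' f g := by
    simp only [eval_add]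
    exact intervalIntegral.integral_add (f.continuous.intervalIntegrable _ _)
      (g.continuous.intervalIntegrable _ _)
  map_smul' c f := by
    simp [eval_smul]

open Polynomial in
lemma II_apply (f : ℝ[X]) : II f = ∫ x in (0:ℝ)..1, f.eval x := rfl

open Polynomial in
lemma II_deriv (f : ℝ[X]) : II (derivative f) = f.eval 1 - f.eval 0 := by
  rw [II_apply]
  exact intervalIntegral.integral_eq_sub_of_hasDerivAt (fun x _ => f.hasDerivAt x)
    ((derivative f).continuous.intervalIntegrable _ _)

open Polynomial in
lemma II_orth_aux (n k : ℕ) (hk : k ≤ n) (f : ℝ[X]) (hf : f.degree < k) :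
    II (f * derivative^[k] (X ^ n * (1 - X) ^ n)) = 0 := by
  induction k generalizing f with
  | zero =>
    have : f = 0 := by
      rw [← degree_eq_bot]; simpa using hf
    simp [this]
  | succ k ih =>
    set G := derivative^[k] (X ^ n * (1 - X) ^ n : ℝ[X]) with hG
    have h0 : G.eval 0 = 0 := by
      have h1 : (X : ℝ[X]) ^ (n - k) ∣ G :=
        pow_sub_dvd_iterate_derivative_of_pow_dvd k (Dvd.intro _ rfl)
      obtain ⟨g, hg⟩ := h1
      have : n - k ≠ 0 := by omega
      simp [hg, this]
    have h1 : G.eval 1 = 0 := by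
      have h1 : (1 - X : ℝ[X]) ^ (n - k) ∣ G :=
        pow_sub_dvd_iterate_derivative_of_pow_dvd k (Dvd.intro_left _ rfl)
      obtain ⟨g, hg⟩ := h1
      have : n - k ≠ 0 := by omega
      simp [hg, this]
    have h2 : II (derivative f * G) = 0 := by
      apply ih (by omega)
      by_cases h : f = 0
      · simp [h]
      · have := degree_derivative_lt h
        have h3 : f.degree ≤ k := by
          rw [degree_le_iff_coeff_zero]
          intro m hm
          have hm' : k < m := by exact_mod_cast hm
          exact (degree_lt_iff_coeff_zero _ _).mp hf m hm'
        exact lt_of_lt_of_le this h3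
    have h3 := II_deriv (f * G)
    rw [derivative_mul, map_add, h2] at h3
    rw [Function.iterate_succ_apply', ← hG]
    simpa [h0, h1] using h3

open Polynomial in
/-- real shifted Legendre polynomial -/
noncomputable def LL (n : ℕ) : ℝ[X] := (shiftedLegendre n).map (Int.castRingHom ℝ)

open Polynomial in
lemma LL_degree (n : ℕ) : (LL n).degree = n := by
  rw [LL, degree_map_eq_of_injective (Int.castRingHom ℝ).injective_int, degree_shiftedLegendre]

open Polynomial in
lemma LL_zero (n : ℕ) : (LL n).eval 0 = 1 := by
  rw [← coeff_zero_eq_eval_zero, LL, coeff_map, coeff_shiftedLegendre]; simp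

open Polynomial in
lemma LL_one (n : ℕ) : (LL n).eval 1 = (-1) ^ n := by
  have h := shiftedLegendre_eval_symm n (1:ℝ)
  have h2 := LL_zero n
  simp only [LL, eval_map, aeval_def, sub_self] at *
  have e : algebraMap ℤ ℝ = Int.castRingHom ℝ := rfl
  rw [e] at h
  rw [h, h2, mul_one]

open Polynomial in
lemma LL_orth (n : ℕ) (f : ℝ[X]) (hf : f.degree < n) : II (f * LL n) = 0 := by
  have h := congrArg (Polynomial.map (Int.castRingHom ℝ)) (factorial_mul_shiftedLegendre_eq n)
  rw [← iterate_derivative_map] at h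
  simp only [Polynomial.map_mul, Polynomial.map_pow, Polynomial.map_sub, Polynomial.map_X,
    Polynomial.map_one, Polynomial.map_natCast] at h
  have h2 := II_orth_aux n n le_rfl f hf
  rw [← h] at h2
  have h3 : f * ((n.factorial : ℝ[X]) * map (Int.castRingHom ℝ) (shiftedLegendre n))
      = (n.factorial : ℝ) • (f * LL n) := by
    rw [LL, smul_eq_C_mul, C_eq_natCast]; ring
  rw [h3, map_smul, smul_eq_mul] at h2
  rcases mul_eq_zero.mp h2 with h4 | h4
  · exact absurd h4 (by positivity)
  · exact h4

open Polynomial in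
lemma LL_norm (n : ℕ) : II (LL n * LL n) = 1 / (2 * n + 1) := by
  have hd : (X * derivative (LL n) - C (n:ℝ) * LL n).degree < (n : WithBot ℕ) := by
    rw [degree_lt_iff_coeff_zero]
    intro m hm
    rcases m with _ | m
    · have : n = 0 := by omega
      simp [this]
    · rw [coeff_sub, coeff_X_mul, coeff_derivative, coeff_C_mul]
      rcases hm.eq_or_lt with h | h
      · subst h; push_cast; ring
      · have : (LL n).coeff (m+1) = 0 := by
          apply coeff_eq_zero_of_degree_lt
          rw [LL_degree]; exact_mod_cast h
        simp [this]
  have h1 := LL_orth n _ hd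
  have h2 := II_deriv (X * (LL n * LL n))
  have e : derivative (X * (LL n * LL n)) =
    (2:ℝ) • ((X * derivative (LL n) - C (n:ℝ) * LL n) * LL n)
      + (2 * n + 1 : ℝ) • (LL n * LL n) := by
    simp only [derivative_mul, derivative_X, smul_eq_C_mul, C_add, C_mul, C_1]
    have : (C (2:ℝ)) = 2 := rfl
    rw [this]; ring
  rw [e, map_add, map_smul, map_smul, h1] at h2
  simp only [smul_eq_mul, eval_mul, eval_X, LL_one, LL_zero] at h2
  have h3 : ((-1:ℝ)^n * (-1)^n) = 1 := by rw [← mul_pow]; simp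
  rw [h3] at h2
  have : (2 * n + 1 : ℝ) ≠ 0 := by positivity
  field_simp
  linarith

lemma LL_inner (m n : ℕ) : II (LL m * LL n) = if m = n then (1 / (2 * (n:ℝ) + 1)) else 0 := by
  split_ifs with h
  · subst h; exact LL_norm m
  · rcases lt_or_gt_of_ne h with h | h
    · exact LL_orth n _ (by rw [LL_degree]; exact_mod_cast h)
    · rw [mul_comm]; exact LL_orth m _ (by rw [LL_degree]; exact_mod_cast h)

open Polynomial in
lemma LL_sum_inner (N : ℕ) (c d : ℕ → ℝ) :
    II ((∑ k ∈ Finset.range N, c k • LL k) * (∑ k ∈ Finset.range N, d k • LL k))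
      = ∑ k ∈ Finset.range N, c k * d k / (2 * (k:ℝ) + 1) := by
  rw [Finset.sum_mul_sum, map_sum]
  apply Finset.sum_congr rfl
  intro i hi
  rw [map_sum]
  simp only [smul_mul_smul_comm, map_smul, LL_inner, smul_eq_mul]
  simp only [mul_ite, mul_zero, Finset.sum_ite_eq, hi, if_true]
  ring

open Polynomial in
lemma LL_expand (n : ℕ) (f : ℝ[X]) (hf : f.degree < n) :
    ∃ c : ℕ → ℝ, (∀ k, n ≤ k → c k = 0) ∧ f = ∑ k ∈ Finset.range n, c k • LL k := by
  induction n generalizing f with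
  | zero =>
    have : f = 0 := by
      rw [← degree_eq_bot]; simpa using hf
    exact ⟨0, by simp [this]⟩
  | succ n ih =>
    have hl : (LL n).coeff n ≠ 0 := by
      apply coeff_ne_zero_of_eq_degree (LL_degree n)
    obtain ⟨c, hc, hs⟩ := ih (f - (f.coeff n / (LL n).coeff n) • LL n) (by
      rw [degree_lt_iff_coeff_zero]
      intro m hm
      rw [coeff_sub, coeff_smul, smul_eq_mul]
      rcases hm.eq_or_lt with h | h
      · subst h; field_simp; ring
      · have h1 : (LL n).coeff m = 0 := by
          apply coeff_eq_zero_of_degree_lt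
          rw [LL_degree]; exact_mod_cast h
        have h2 : f.coeff m = 0 := (degree_lt_iff_coeff_zero _ _).mp hf m h
        simp [h1, h2])
    refine ⟨fun k => if k = n then f.coeff n / (LL n).coeff n else c k, ?_, ?_⟩
    · intro k hk
      have : k ≠ n := by omega
      simp [this, hc k (by omega)]
    · rw [Finset.sum_range_succ]
      rw [sub_eq_iff_eq_add] at hs
      simp only [if_true]
      rw [hs]
      congr 1
      · apply Finset.sum_congr rfl
        intro k hk
        have : k ≠ n := by simp at hk; omega
        simp [this]
      · rw [← hs]

/-- even / odd weights; `s = 1` even, `s = -1` odd -/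
noncomputable def ww (s : ℝ) (k : ℕ) : ℝ := (1 + s * (-1) ^ k) / 2

noncomputable def AA (s : ℝ) (N : ℕ) : ℝ := ∑ k ∈ Finset.range N, ww s k * (2 * (k:ℝ) + 1)

lemma AA_eq (s : ℝ) (N : ℕ) : AA s N = ((N:ℝ)^2 - s * (-1) ^ N * N) / 2 := by
  induction N with
  | zero => simp [AA]
  | succ n ih =>
    rw [AA, Finset.sum_range_succ, ← AA, ih, ww]; push_cast; ring

lemma ww_sq (s : ℝ) (hs : s = 1 ∨ s = -1) (k : ℕ) : ww s k * ww s k = ww s k := by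
  rcases neg_one_pow_eq_or ℝ k with h | h <;> rcases hs with rfl | rfl <;> norm_num [ww, h]

lemma AA_le (s : ℝ) (hs : s = 1 ∨ s = -1) (q : ℕ) (hq : 2 ≤ q) :
    2 * AA s (q+1) ≤ AA s (2*q+1) := by
  rw [AA_eq, AA_eq]
  have h1 : (-1:ℝ)^(2*q+1) = -1 := by rw [pow_succ, pow_mul]; simp
  rw [h1]
  have hq' : (2:ℝ) ≤ q := by exact_mod_cast hq
  push_cast
  rcases hs with rfl | rfl
  · rcases neg_one_pow_eq_or ℝ (q+1) with h | h <;> rw [h] <;> nlinarith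
  · rcases neg_one_pow_eq_or ℝ (q+1) with h | h <;> rw [h]
    · have : q ≠ 2 := by rintro rfl; norm_num at h
      have : (3:ℝ) ≤ q := by exact_mod_cast (by omega : 3 ≤ q)
      nlinarith
    · nlinarith

lemma AA_pos (s : ℝ) (hs : s = 1 ∨ s = -1) (q : ℕ) (hq : 2 ≤ q) : 0 < AA s (2*q+1) := by
  rw [AA_eq]
  have h1 : (-1:ℝ)^(2*q+1) = -1 := by rw [pow_succ, pow_mul]; simp
  rw [h1]
  have hq' : (2:ℝ) ≤ q := by exact_mod_cast hq
  push_cast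
  rcases hs with rfl | rfl <;> nlinarith

lemma CS (s : ℝ) (hs : s = 1 ∨ s = -1) (N : ℕ) (c : ℕ → ℝ) :
    (∑ k ∈ Finset.range N, ww s k * c k) ^ 2 ≤
      AA s N * ∑ k ∈ Finset.range N, ww s k * (c k * c k / (2 * (k:ℝ) + 1)) := by
  have hw : ∀ k, 0 ≤ ww s k := fun k => by rw [← ww_sq s hs k]; exact mul_self_nonneg _
  apply Finset.sum_sq_le_sum_mul_sum_of_sq_eq_mul
  · intro k _; have := hw k; positivity
  · intro k _; have := hw k
    have := mul_self_nonneg (c k)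
    positivity
  · intro k _
    have : (2 * (k:ℝ) + 1) ≠ 0 := by positivity
    field_simp

open Polynomial in
lemma main_aux (q : ℕ) (hq : 2 ≤ q) (μ : ℝ[X]) (hμ : μ.natDegree ≤ q) :
    ∃ v : ℝ[X], v.natDegree ≤ 2*q ∧ v.eval 0 = 0 ∧ v.eval 1 = 0 ∧
      II (μ * v) = II (v * v) ∧ II (μ * μ) ≤ 2 * II (v * v) := by
  obtain ⟨c, hc, hs⟩ := LL_expand (q+1) μ (by
    rw [degree_lt_iff_coeff_zero]
    intro m hm
    exact coeff_eq_zero_of_natDegree_lt (by omega))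
  have ext : ∀ {M : Type} [AddCommMonoid M] (F : ℕ → M), (∀ k, q+1 ≤ k → F k = 0) →
      ∑ k ∈ Finset.range (q+1), F k = ∑ k ∈ Finset.range (2*q+1), F k := by
    intro M _ F hF
    apply Finset.sum_subset
    · intro k; simp; omega
    · intro k _ h; exact hF k (by simpa using h)
  rw [ext _ (fun k hk => by simp [hc k hk])] at hs
  set N := 2*q+1 with hN
  have h1 : (1:ℝ) = 1 ∨ (1:ℝ) = -1 := Or.inl rfl
  have h2 : (-1:ℝ) = 1 ∨ (-1:ℝ) = -1 := Or.inr rfl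
  have A1 := AA_pos 1 h1 q hq
  have A2 := AA_pos (-1) h2 q hq
  have B1 := AA_le 1 h1 q hq
  have B2 := AA_le (-1) h2 q hq
  have C1 := CS 1 h1 (q+1) c
  have C2 := CS (-1) h2 (q+1) c
  rw [ext _ (fun k hk => by simp [hc k hk]), ext _ (fun k hk => by simp [hc k hk])] at C1 C2
  rw [← hN] at A1 A2 B1 B2
  set a := ∑ k ∈ Finset.range N, ww 1 k * c k with ha
  set b := ∑ k ∈ Finset.range N, ww (-1) k * c k with hb
  set S1 := ∑ k ∈ Finset.range N, ww 1 k * (c k * c k / (2 * (k:ℝ) + 1)) with hS1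
  set S2 := ∑ k ∈ Finset.range N, ww (-1) k * (c k * c k / (2 * (k:ℝ) + 1)) with hS2
  set A := AA 1 N with hA
  set B := AA (-1) N with hB
  have hn : ∀ k : ℕ, (2 * (k:ℝ) + 1) ≠ 0 := fun k => by positivity
  have hsum : ∀ k, ww 1 k + ww (-1) k = 1 := fun k => by simp only [ww]; ring
  have hprod : ∀ k, ww 1 k * ww (-1) k = 0 := fun k => by
    rcases neg_one_pow_eq_or ℝ k with h | h <;> norm_num [ww, h]
  have hdiff : ∀ k, (-1)^k = ww 1 k - ww (-1) k := fun k => by simp only [ww]; ring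
  let d : ℕ → ℝ := fun k => c k - (2 * (k:ℝ) + 1) * (a / A * ww 1 k + b / B * ww (-1) k)
  let v : ℝ[X] := ∑ k ∈ Finset.range N, d k • LL k
  have hab : ∑ k ∈ Finset.range N, ww 1 k * d k = 0 := by
    have : ∀ k, ww 1 k * d k = ww 1 k * c k - a / A * (ww 1 k * (2 * (k:ℝ) + 1)) := by
      intro k
      simp only [d]
      linear_combination (-(2 * (k:ℝ) + 1) * (a / A)) * ww_sq 1 h1 k
        - (2 * (k:ℝ) + 1) * (b / B) * hprod k
    simp only [this, Finset.sum_sub_distrib, ← Finset.mul_sum]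
    rw [← ha]; change a - a / A * A = 0
    field_simp; ring
  have hbb : ∑ k ∈ Finset.range N, ww (-1) k * d k = 0 := by
    have : ∀ k, ww (-1) k * d k = ww (-1) k * c k - b / B * (ww (-1) k * (2 * (k:ℝ) + 1)) := by
      intro k
      simp only [d]
      linear_combination (-(2 * (k:ℝ) + 1) * (b / B)) * ww_sq (-1) h2 k
        - (2 * (k:ℝ) + 1) * (a / A) * hprod k
    simp only [this, Finset.sum_sub_distrib, ← Finset.mul_sum]
    rw [← hb]; change b - b / B * B = 0
    field_simp; ring
  have hμμ : II (μ * μ) = S1 + S2 := by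
    rw [hs, LL_sum_inner, hS1, hS2, ← Finset.sum_add_distrib]
    apply Finset.sum_congr rfl
    intro k _
    rw [← add_mul, hsum, one_mul]
  have hμv : II (μ * v) = S1 + S2 - a^2 / A - b^2 / B := by
    rw [← hμμ, hs, LL_sum_inner, LL_sum_inner]
    have : ∀ k, c k * d k / (2 * (k:ℝ) + 1) = c k * c k / (2 * (k:ℝ) + 1)
        - a / A * (ww 1 k * c k) - b / B * (ww (-1) k * c k) := by
      intro k
      have := hn k
      simp only [d]
      generalize a / A = x
      generalize b / B = y
      field_simp
      ring
    simp only [this, Finset.sum_sub_distrib, ← Finset.mul_sum]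
    rw [← ha, ← hb]; ring
  have hvv : II (μ * v) = II (v * v) := by
    rw [hs, LL_sum_inner, LL_sum_inner]
    have : ∀ k, c k * d k / (2 * (k:ℝ) + 1) = d k * d k / (2 * (k:ℝ) + 1)
        + a / A * (ww 1 k * d k) + b / B * (ww (-1) k * d k) := by
      intro k
      have := hn k
      have e : c k = d k + (2 * (k:ℝ) + 1) * (a / A * ww 1 k + b / B * ww (-1) k) := by
        simp only [d]; ring
      rw [e]
      generalize d k = z
      generalize a / A = x
      generalize b / B = y
      field_simp
      ring
    simp only [this, Finset.sum_add_distrib, ← Finset.mul_sum]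
    rw [hab, hbb]; ring
  have S1n : 0 ≤ S1 := Finset.sum_nonneg fun k _ => by
    have := ww_sq 1 h1 k
    have := mul_self_nonneg (ww 1 k)
    have := mul_self_nonneg (c k)
    have : 0 ≤ ww 1 k := by linarith
    positivity
  have S2n : 0 ≤ S2 := Finset.sum_nonneg fun k _ => by
    have := ww_sq (-1) h2 k
    have := mul_self_nonneg (ww (-1) k)
    have := mul_self_nonneg (c k)
    have : 0 ≤ ww (-1) k := by linarith
    positivity
  have D1 : a^2 / A ≤ S1 / 2 := by
    rw [div_le_iff₀ A1]; nlinarith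
  have D2 : b^2 / B ≤ S2 / 2 := by
    rw [div_le_iff₀ A2]; nlinarith
  refine ⟨v, ?_, ?_, ?_, hvv, ?_⟩
  · apply natDegree_sum_le_of_forall_le
    intro k hk
    refine (natDegree_smul_le _ _).trans ?_
    rw [natDegree_eq_of_degree_eq_some (LL_degree k)]
    have := Finset.mem_range.mp hk
    omega
  · simp only [v, eval_finset_sum, eval_smul, LL_zero, smul_eq_mul, mul_one]
    calc _ = ∑ k ∈ Finset.range N, (ww 1 k * d k + ww (-1) k * d k) :=
          Finset.sum_congr rfl fun k _ => by rw [← add_mul, hsum, one_mul]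
      _ = 0 := by rw [Finset.sum_add_distrib, hab, hbb, add_zero]
  · simp only [v, eval_finset_sum, eval_smul, LL_one, smul_eq_mul]
    calc _ = ∑ k ∈ Finset.range N, (ww 1 k * d k - ww (-1) k * d k) :=
          Finset.sum_congr rfl fun k _ => by rw [hdiff]; ring
      _ = 0 := by rw [Finset.sum_sub_distrib, hab, hbb, sub_zero]
  · rw [← hvv, hμv, hμμ]; linarith

/-- Optimal inf–sup condition of Remark 5.1: q ≥ 2 and p = 2q. -/
theorem local_inf_sup_optimal (q : ℕ) (hq : 2 ≤ q)
    (μ : Polynomial ℝ) (hμ : μ.natDegree ≤ q) :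
    ∃ v : Polynomial ℝ, v ≠ 0 ∧ v.natDegree ≤ 2*q ∧ v.eval 0 = 0 ∧ v.eval 1 = 0 ∧
      (∫ x in (0:ℝ)..1, μ.eval x * v.eval x)
        ≥ (1 / Real.sqrt 2)
            * Real.sqrt (∫ x in (0:ℝ)..1, (μ.eval x)^2)
            * Real.sqrt (∫ x in (0:ℝ)..1, (v.eval x)^2) := by
  obtain ⟨v, hd, h0, h1, e, hle⟩ := main_aux q hq μ hμ
  have conv : ∀ f g : Polynomial ℝ, II (f * g) = ∫ x in (0:ℝ)..1, f.eval x * g.eval x := by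
    intro f g; rw [II_apply]; simp only [Polynomial.eval_mul]
  simp only [pow_two, ← conv]
  by_cases hv : v = 0
  · refine ⟨Polynomial.X - Polynomial.X ^ 2, ?_, ?_, by simp, by simp, ?_⟩
    · intro h
      have := congrArg (Polynomial.eval 2) h
      norm_num at this
    · refine (Polynomial.natDegree_sub_le _ _).trans ?_
      simp; omega
    · have hm0 : II (μ * μ) ≤ 0 := by simpa [hv] using hle
      have hc : Continuous (fun x => μ.eval x * μ.eval x) := μ.continuous.mul μ.continuous
      have hz : μ = 0 := by
        by_contra hne
        have : 0 < II (μ * μ) := by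
          rw [conv]
          obtain ⟨x, hx, hx'⟩ : ∃ x ∈ Set.Icc (0:ℝ) 1, μ.eval x ≠ 0 := by
            by_contra hcon
            push Not at hcon
            apply hne
            apply Polynomial.eq_zero_of_infinite_isRoot
            exact (Set.Icc_infinite (by norm_num : (0:ℝ) < 1)).mono hcon
          exact intervalIntegral.integral_pos (by norm_num) hc.continuousOn
            (fun y _ => mul_self_nonneg _) ⟨x, hx, mul_self_pos.mpr hx'⟩
        linarith
      simp [hz]
  · refine ⟨v, hv, hd, h0, h1, ?_⟩
    rw [e]
    have hvn : 0 ≤ II (v * v) := by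
      rw [conv]
      exact intervalIntegral.integral_nonneg (by norm_num) (fun y _ => mul_self_nonneg _)
    have h3 : Real.sqrt (II (μ * μ)) ≤ Real.sqrt 2 * Real.sqrt (II (v * v)) := by
      rw [← Real.sqrt_mul (by norm_num)]
      exact Real.sqrt_le_sqrt hle
    have h4 : 1 / Real.sqrt 2 * Real.sqrt (II (μ * μ)) ≤ Real.sqrt (II (v * v)) := by
      rw [one_div, inv_mul_le_iff₀ (by positivity)]; exact h3
    calc _ ≤ Real.sqrt (II (v * v)) * Real.sqrt (II (v * v)) :=
          mul_le_mul_of_nonneg_right h4 (Real.sqrt_nonneg _)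
      _ = _ := Real.mul_self_sqrt hvn
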